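/- Let 0 ≤ 2f ≤ n, and define y_f := Ŝ_n · Ê_f · Ĥ_f and x_f := (H_f⁻¹)^ · Ŝ_{{2f+1,…,n}} · Ê_f · Ĥ_f in A, where H_f⁻¹ = {d⁻¹ : d ∈ H_f(n)} and S_{{2f+1,…,n}} is the subgroup of S_n of permutations fixing 1,…,2f pointwise. Then y_f = (1 + qr⁻¹)^f · a_f · x_f, where a_0 = 1 and a_i = a_{i−1}·(Σ_{k=0}^{i−1} q^{2k}) for i ≥ 1. -/

import Mathlib

open Finset
open scoped Pointwise

namespace BMWPaper

/-- The Coxeter length of a permutation of `Fin n`: the number of inversions. -/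
def len {n : ℕ} (w : Equiv.Perm (Fin n)) : ℕ :=
  (Finset.univ.filter (fun p : Fin n × Fin n => p.1 < p.2 ∧ w p.2 < w p.1)).card

/-- `sGen n i` is the adjacent transposition `s_i = (i, i+1)` (1-based) in `S_n`;
it is the identity for out-of-range `i`. -/
def sGen (n i : ℕ) : Equiv.Perm (Fin n) :=
  if h : 1 ≤ i ∧ i < n then Equiv.swap ⟨i - 1, by omega⟩ ⟨i, h.2⟩ else 1

/-- `pimg d i` is the (1-based) image `(i)d` of the point `i ∈ {1,…,n}` under the
*right* action of the permutation `d` (permutations act on points on the right,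
so that `(a)(στ) = ((a)σ)τ` for the group multiplication `σ * τ`);
the junk value `0` is returned for out-of-range `i`. -/
def pimg {n : ℕ} (d : Equiv.Perm (Fin n)) (i : ℕ) : ℕ :=
  if h : i - 1 < n then ((d⁻¹ ⟨i - 1, h⟩ : Fin n) : ℕ) + 1 else 0

open scoped Classical in
/-- `Hset n f` is the set `H_f(n)` of all `d ∈ S_n` such that
`(1)d < (3)d < ⋯ < (2f-1)d`, `(2i-1)d < (2i)d` for `i = 1,…,f`, and
`(2f+1)d < (2f+2)d < ⋯ < (n)d`. -/
noncomputable def Hset (n f : ℕ) : Finset (Equiv.Perm (Fin n)) :=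
  Finset.univ.filter (fun d =>
    (∀ i ∈ Finset.Icc 1 (f - 1), pimg d (2 * i - 1) < pimg d (2 * i + 1)) ∧
    (∀ i ∈ Finset.Icc 1 f, pimg d (2 * i - 1) < pimg d (2 * i)) ∧
    (∀ j ∈ Finset.Icc (2 * f + 1) (n - 1), pimg d j < pimg d (j + 1)))

/-- The index of the block of the composition `μ` containing the (0-based) point `k`. -/
def blockOf (μ : List ℕ) (k : ℕ) : ℕ :=
  ((List.range μ.length).filter (fun j => (μ.take (j + 1)).sum ≤ k)).length

open scoped Classical in
/-- The Young subgroup `S_μ` of `S_n` associated with a composition `μ` of `n`,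
as the set of permutations preserving each of the consecutive blocks of `μ`. -/
noncomputable def youngSet (n : ℕ) (μ : List ℕ) : Finset (Equiv.Perm (Fin n)) :=
  Finset.univ.filter (fun w => ∀ a : Fin n, blockOf μ ((w a : ℕ)) = blockOf μ (a : ℕ))

open scoped Classical in
/-- The set `D_μ` of minimal-length right coset representatives of `S_μ` in `S_n`:
the elements of minimal length in their right coset `S_μ d`. -/
noncomputable def Dset (n : ℕ) (μ : List ℕ) : Finset (Equiv.Perm (Fin n)) :=
  Finset.univ.filter (fun d => ∀ u ∈ youngSet n μ, len d ≤ len (u * d))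

/-- The identification of `Fin m` with the block `[k, k+m)` of `Fin n` (0-based). -/
def shiftEquiv (n k m : ℕ) (h : k + m ≤ n) :
    Fin m ≃ {a : Fin n // k ≤ (a : ℕ) ∧ (a : ℕ) < k + m} where
  toFun b := ⟨⟨k + (b : ℕ), by have := b.isLt; omega⟩, by
    constructor
    · exact Nat.le_add_right _ _
    · have := b.isLt; simp only [Fin.val_mk]; omega⟩
  invFun a := ⟨(a : Fin n) - k, by have := a.2; omega⟩
  left_inv b := by
    apply Fin.ext
    simp
  right_inv a := by
    apply Subtype.ext
    apply Fin.ext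
    have := a.2
    simp only []
    omega

open scoped Classical in
/-- The embedding of `S_m` into `S_n` as the group of permutations of the
(1-based) block `{k+1, …, k+m}` of `{1, …, n}`. -/
noncomputable def shiftEmb (n k m : ℕ) (w : Equiv.Perm (Fin m)) : Equiv.Perm (Fin n) :=
  if h : k + m ≤ n then w.extendDomain (shiftEquiv n k m h) else 1

open scoped Classical in
/-- The subgroup of `S_n` of permutations fixing the (1-based) points `1, …, k`. -/
noncomputable def fixSet (n k : ℕ) : Finset (Equiv.Perm (Fin n)) :=
  Finset.univ.filter (fun w => ∀ a : Fin n, (a : ℕ) < k → w a = a)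


/-- `bbs n i` is the permutation `𝕤_i = s_{2i} s_{2i-1} s_{2i+1} s_{2i} = (2i-1, 2i+1)(2i, 2i+2)`. -/
def bbs (n i : ℕ) : Equiv.Perm (Fin n) :=
  sGen n (2 * i) * sGen n (2 * i - 1) * sGen n (2 * i + 1) * sGen n (2 * i)

open scoped Classical in
/-- The set `𝔻_{(1,f-1)} = {𝕤_1 𝕤_2 ⋯ 𝕤_k : k = 0, …, f-1}` in `S_{2f}`. -/
noncomputable def bbD1 (f : ℕ) : Finset (Equiv.Perm (Fin (2 * f))) :=
  (Finset.range f).image (fun k => ((List.range k).map (fun j => bbs (2 * f) (j + 1))).prod)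

open scoped Classical in
/-- The set `𝔻_{(1,f-2)}^{{2,…,f}} = {𝕤_2 𝕤_3 ⋯ 𝕤_k : k = 1, …, f-1}` in `S_{2f}`. -/
noncomputable def bbD1' (f : ℕ) : Finset (Equiv.Perm (Fin (2 * f))) :=
  (Finset.Icc 1 (f - 1)).image
    (fun k => ((List.range (k - 1)).map (fun j => bbs (2 * f) (j + 2))).prod)

open scoped Classical in
/-- `H_f^{(a)} = {d ∈ H_f(n) : (1)d⁻¹ = 1, (2)d⁻¹ = 2}`. -/
noncomputable def HsetA (n f : ℕ) : Finset (Equiv.Perm (Fin n)) :=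
  (Hset n f).filter (fun d => pimg d⁻¹ 1 = 1 ∧ pimg d⁻¹ 2 = 2)

open scoped Classical in
/-- `H_f^{(b)} = {d ∈ H_f(n) : (1)d⁻¹ = 1, (2)d⁻¹ = 3}`. -/
noncomputable def HsetB (n f : ℕ) : Finset (Equiv.Perm (Fin n)) :=
  (Hset n f).filter (fun d => pimg d⁻¹ 1 = 1 ∧ pimg d⁻¹ 2 = 3)

open scoped Classical in
/-- `H_f^{(c)} = {d ∈ H_f(n) : (1)d⁻¹ = 1, (2)d⁻¹ = 2f+1}`. -/
noncomputable def HsetC (n f : ℕ) : Finset (Equiv.Perm (Fin n)) :=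
  (Hset n f).filter (fun d => pimg d⁻¹ 1 = 1 ∧ pimg d⁻¹ 2 = 2 * f + 1)

open scoped Classical in
/-- `H_f^{(d)} = {d ∈ H_f(n) : (1)d⁻¹ = 2f+1, (2)d⁻¹ = 1}`. -/
noncomputable def HsetD (n f : ℕ) : Finset (Equiv.Perm (Fin n)) :=
  (Hset n f).filter (fun d => pimg d⁻¹ 1 = 2 * f + 1 ∧ pimg d⁻¹ 2 = 1)

open scoped Classical in
/-- `H_f^{(e)} = {d ∈ H_f(n) : (1)d⁻¹ = 2f+1, (2)d⁻¹ = 2f+2}`. -/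
noncomputable def HsetE (n f : ℕ) : Finset (Equiv.Perm (Fin n)) :=
  (Hset n f).filter (fun d => pimg d⁻¹ 1 = 2 * f + 1 ∧ pimg d⁻¹ 2 = 2 * f + 2)

section Algebra

variable {F : Type*} [Field F] {A : Type*} [Ring A] [Algebra F A]

/-- For a set `S` of permutations, `hat c Tw S = Σ_{w ∈ S} c^{ℓ(w)} T_w`. -/
noncomputable def hat {n : ℕ} (c : F) (Tw : Equiv.Perm (Fin n) → A)
    (S : Finset (Equiv.Perm (Fin n))) : A :=
  ∑ w ∈ S, c ^ len w • Tw w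

/-- `Ehat E f = E_1 E_3 ⋯ E_{2f-1}`. -/
def Ehat (E : ℕ → A) (f : ℕ) : A := ((List.range f).map (fun i => E (2 * i + 1))).prod

/-- `Tprod T a b = T_a T_{a+1} ⋯ T_b` (the empty product `1` if `b < a`). -/
def Tprod (T : ℕ → A) (a b : ℕ) : A := ((List.range (b + 1 - a)).map (fun t => T (a + t))).prod

/-- `sDesc n a b = s_a s_{a-1} ⋯ s_b` (descending product of adjacent transpositions). -/
def sDesc (n a b : ℕ) : Equiv.Perm (Fin n) :=
  ((List.range (a + 1 - b)).map (fun j => sGen n (a - j))).prod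

/-- The data of a Birman–Murakami–Wenzl algebra structure: an `F`-algebra `A`
with invertible elements `T_1, …, T_{n-1}` and elements `E_1, …, E_{n-1}`
satisfying the BMW relations, together with a map `w ↦ T_w` from `S_n` to `A`
with `T_id = 1`, `T_{s_i} = T_i` and `T_{uv} = T_u T_v` whenever lengths add. -/
structure BMWData (F : Type*) [Field F] (A : Type*) [Ring A] [Algebra F A]
    (n : ℕ) (q r : F) where
  T : ℕ → A
  Tinv : ℕ → A
  E : ℕ → A
  Tw : Equiv.Perm (Fin n) → A
  hq : q ≠ 0
  hr : r ≠ 0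
  hqq : q - q⁻¹ ≠ 0
  T_mul_Tinv : ∀ i, 1 ≤ i → i ≤ n - 1 → T i * Tinv i = 1
  Tinv_mul_T : ∀ i, 1 ≤ i → i ≤ n - 1 → Tinv i * T i = 1
  skein : ∀ i, 1 ≤ i → i ≤ n - 1 → T i - Tinv i = (q - q⁻¹) • (1 - E i)
  Esq : ∀ i, 1 ≤ i → i ≤ n - 1 → E i * E i = (1 + (r - r⁻¹) / (q - q⁻¹)) • E i
  braid : ∀ i, 1 ≤ i → i + 1 ≤ n - 1 → T i * T (i + 1) * T i = T (i + 1) * T i * T (i + 1)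
  T_comm : ∀ i j, 1 ≤ i → i ≤ n - 1 → 1 ≤ j → j ≤ n - 1 → (i + 1 < j ∨ j + 1 < i) →
    T i * T j = T j * T i
  EEE₁ : ∀ i, 1 ≤ i → i + 1 ≤ n - 1 → E i * E (i + 1) * E i = E i
  EEE₂ : ∀ i, 1 ≤ i → i + 1 ≤ n - 1 → E (i + 1) * E i * E (i + 1) = E (i + 1)
  TTE₁ : ∀ i, 1 ≤ i → i + 1 ≤ n - 1 → T i * T (i + 1) * E i = E (i + 1) * E i
  TTE₂ : ∀ i, 1 ≤ i → i + 1 ≤ n - 1 → T (i + 1) * T i * E (i + 1) = E i * E (i + 1)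
  ET : ∀ i, 1 ≤ i → i ≤ n - 1 → E i * T i = r⁻¹ • E i
  TE : ∀ i, 1 ≤ i → i ≤ n - 1 → T i * E i = r⁻¹ • E i
  ETE₁ : ∀ i, 1 ≤ i → i + 1 ≤ n - 1 → E i * T (i + 1) * E i = r • E i
  ETE₂ : ∀ i, 1 ≤ i → i + 1 ≤ n - 1 → E (i + 1) * T i * E (i + 1) = r • E (i + 1)
  Tw_one : Tw 1 = 1
  Tw_s : ∀ i, 1 ≤ i → i ≤ n - 1 → Tw (sGen n i) = T i
  Tw_mul : ∀ u v : Equiv.Perm (Fin n), len (u * v) = len u + len v →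
    Tw (u * v) = Tw u * Tw v

/-- The scalars `a_f` defined by `a_0 = 1` and `a_i = a_{i-1} · Σ_{k=0}^{i-1} q^{2k}`. -/
noncomputable def aseq (q : F) : ℕ → F
  | 0 => 1
  | (i + 1) => aseq q i * (∑ k ∈ Finset.range (i + 1), q ^ (2 * k))


/-- The scalars `c_f` defined by `c_0 = 1` and
`c_f = -((q^{4f-3} - q^{2f-3})/(r q^{2n-2f-2} - q⁻¹)) · c_{f-1}`. -/
noncomputable def cseq (q r : F) (n : ℕ) : ℕ → F
  | 0 => 1
  | (f + 1) =>
      -((q ^ (4 * ((f : ℤ) + 1) - 3) - q ^ (2 * ((f : ℤ) + 1) - 3)) /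
          (r * q ^ (2 * (n : ℤ) - 2 * ((f : ℤ) + 1) - 2) - q⁻¹)) * cseq q r n f

/-- The scalars `č_f` defined by `č_0 = 1` and
`č_f = (q^{3-4f}(1 - q^{2f})/(q + r q^{2+2f-2n})) · č_{f-1}` (with integer exponents). -/
noncomputable def ccseq (q r : F) (n : ℕ) : ℕ → F
  | 0 => 1
  | (f + 1) =>
      (q ^ ((3 : ℤ) - 4 * ((f : ℤ) + 1)) * (1 - q ^ (2 * (f + 1))) /
          (q + r * q ^ ((2 : ℤ) + 2 * ((f : ℤ) + 1) - 2 * (n : ℤ)))) * ccseq q r n f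

/-- The element `x_f = (H_f⁻¹)^ · Ŝ_{{2f+1,…,n}} · Ê_f · Ĥ_f` of the BMW algebra. -/
noncomputable def xEl {F : Type*} [Field F] {A : Type*} [Ring A] [Algebra F A]
    {n : ℕ} {q r : F} (D : BMWData F A n q r) (f : ℕ) : A :=
  hat q D.Tw ((Hset n f).image (fun d => d⁻¹)) * hat q D.Tw (fixSet n (2 * f)) *
    Ehat D.E f * hat q D.Tw (Hset n f)

/-- The element `x̌_f = (H_f⁻¹)ˇ · Š_{{2f+1,…,n}} · Ê_f · Ȟ_f` of the BMW algebra,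
where `ˇ` is formed with `-q⁻¹` in place of `q`. -/
noncomputable def xElCheck {F : Type*} [Field F] {A : Type*} [Ring A] [Algebra F A]
    {n : ℕ} {q r : F} (D : BMWData F A n q r) (f : ℕ) : A :=
  hat (-q⁻¹) D.Tw ((Hset n f).image (fun d => d⁻¹)) * hat (-q⁻¹) D.Tw (fixSet n (2 * f)) *
    Ehat D.E f * hat (-q⁻¹) D.Tw (Hset n f)

end Algebra

/-- The value of a permutation of `Fin n` at a natural number, with the value `0` out of range. -/
def natVal {n : ℕ} (w : Equiv.Perm (Fin n)) (x : ℕ) : ℕ :=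
  if h : x < n then w ⟨x, h⟩ else 0

lemma natVal_of_lt {n x : ℕ} (w : Equiv.Perm (Fin n)) (h : x < n) :
    natVal w x = w ⟨x, h⟩ := dif_pos h

lemma natVal_coe {n : ℕ} (w : Equiv.Perm (Fin n)) (a : Fin n) : natVal w a = w a :=
  natVal_of_lt w a.2

lemma natVal_injOn {n x y : ℕ} (w : Equiv.Perm (Fin n)) (hx : x < n) (hy : y < n)
    (h : natVal w x = natVal w y) : x = y := by
  rw [natVal_of_lt w hx, natVal_of_lt w hy] at h
  simpa using w.injective (Fin.ext h)

lemma sGen_succ {n j : ℕ} (hj : j + 1 < n) :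
    sGen n (j + 1) = Equiv.swap ⟨j, by omega⟩ ⟨j + 1, hj⟩ := by
  simp [sGen, hj]

lemma sGen_mul_self (n i : ℕ) : sGen n i * sGen n i = 1 := by
  unfold sGen
  split_ifs <;> simp

lemma natVal_mul_sGen {n j : ℕ} (hj : j + 1 < n) (w : Equiv.Perm (Fin n)) (x : ℕ) :
    natVal (w * sGen n (j + 1)) x = natVal w (Equiv.swap j (j + 1) x) := by
  rw [sGen_succ hj]
  unfold natVal
  simp only [Equiv.Perm.mul_apply, Equiv.swap_apply_def, Fin.ext_iff]
  split_ifs <;> first | rfl | omega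

lemma len_mul_sGen {n j : ℕ} (hj : j + 1 < n) (w : Equiv.Perm (Fin n))
    (h : natVal w j < natVal w (j + 1)) : len (w * sGen n (j + 1)) = len w + 1 := by
  classical
  rw [natVal_of_lt w (by omega), natVal_of_lt w hj] at h
  set a : Fin n := ⟨j, by omega⟩ with ha
  set b : Fin n := ⟨j + 1, hj⟩ with hb
  have hs : sGen n (j + 1) = Equiv.swap a b := sGen_succ hj
  have key : (univ.filter fun p : Fin n × Fin n =>
        p.1 < p.2 ∧ (w * sGen n (j + 1)) p.2 < (w * sGen n (j + 1)) p.1) =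
      insert (a, b) ((univ.filter fun p : Fin n × Fin n => p.1 < p.2 ∧ w p.2 < w p.1).map
        ((Equiv.swap a b).prodCongr (Equiv.swap a b)).toEmbedding) := by
    ext ⟨x, y⟩
    rw [mem_insert, Finset.mem_map_equiv]
    simp only [mem_filter, mem_univ, true_and, hs, Equiv.Perm.mul_apply, Prod.mk.injEq,
      Equiv.prodCongr_symm, Equiv.symm_swap, Equiv.prodCongr_apply, Prod.map]
    by_cases hxa : x = a
    · by_cases hyb : y = b
      · simp [hxa, hyb]
        exact ⟨by simp [Fin.lt_def, ha, hb], h⟩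
      · have : x < y ↔ Equiv.swap a b x < Equiv.swap a b y := by
          simp only [Equiv.swap_apply_def]
          simp only [Fin.ext_iff, Fin.lt_def, ha, hb] at *
          split_ifs <;> simp <;> omega
        rw [this]; tauto
    · by_cases hxy : x = b ∧ y = a
      · obtain ⟨rfl, rfl⟩ := hxy
        have h1 : ¬ (b < a) := by simp [Fin.lt_def, ha, hb]
        have h2 : ¬ (w b < w a) := by
          rw [Fin.lt_def]; omega
        simp [h1, h2, hxa]
      · have : x < y ↔ Equiv.swap a b x < Equiv.swap a b y := by
          simp only [Equiv.swap_apply_def]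
          simp only [Fin.ext_iff, Fin.lt_def, ha, hb] at *
          split_ifs <;> simp <;> omega
        rw [this]; tauto
  unfold len
  rw [key, card_insert_of_notMem, card_map]
  rw [Finset.mem_map_equiv]
  have : ¬ (b < a) := by simp [Fin.lt_def, ha, hb]
  simp [this]

lemma len_one {n : ℕ} : len (1 : Equiv.Perm (Fin n)) = 0 := by
  unfold len
  rw [card_eq_zero, filter_eq_empty_iff]
  rintro p - ⟨h1, h2⟩
  exact absurd h1 (not_lt.2 (le_of_lt h2))

lemma len_sGen {n j : ℕ} (hj : j + 1 < n) : len (sGen n (j + 1)) = 1 := by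
  have := len_mul_sGen hj 1 (by
    rw [natVal_of_lt _ hj, natVal_of_lt _ (by omega)]; simp)
  simpa [len_one] using this

lemma len_mul_of_fixes {n K : ℕ} {w u : Equiv.Perm (Fin n)}
    (hw : ∀ a b : Fin n, K ≤ a → a < b → w a < w b)
    (hu : ∀ a : Fin n, (a : ℕ) < K → u a = a) : len (w * u) = len w + len u := by
  classical
  have hu' : ∀ a : Fin n, K ≤ (a : ℕ) → K ≤ (u a : ℕ) := by
    intro a ha
    by_contra hlt
    have := u.injective (hu (u a) (by omega))
    rw [this] at hlt
    omega
  have key : (univ.filter fun p : Fin n × Fin n => p.1 < p.2 ∧ (w * u) p.2 < (w * u) p.1) =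
      ((univ.filter fun p : Fin n × Fin n => p.1 < p.2 ∧ w p.2 < w p.1).map
        (u.symm.prodCongr u.symm).toEmbedding).disjUnion
      (univ.filter fun p : Fin n × Fin n => p.1 < p.2 ∧ u p.2 < u p.1) (by
        rw [Finset.disjoint_left]
        rintro ⟨x, y⟩ h1 h2
        rw [Finset.mem_map_equiv] at h1
        simp at h1 h2
        exact absurd h1.1 (not_lt.2 h2.2.le)) := by
    ext ⟨x, y⟩
    rw [mem_disjUnion, Finset.mem_map_equiv, mem_filter, mem_filter, mem_filter]
    simp only [mem_univ, true_and, Equiv.Perm.mul_apply, Equiv.prodCongr_symm, Equiv.symm_symm,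
      Equiv.prodCongr_apply, Prod.map]
    constructor
    · rintro ⟨hxy, h⟩
      rcases lt_trichotomy (u x) (u y) with h' | h' | h'
      · exact Or.inl ⟨h', h⟩
      · exact absurd (u.injective h') hxy.ne
      · exact Or.inr ⟨hxy, h'⟩
    · rintro (⟨h1, h2⟩ | ⟨h1, h2⟩)
      · refine ⟨?_, h2⟩
        have hx : (u x : ℕ) < K := by
          by_contra hx
          exact absurd (hw _ _ (not_lt.1 hx) h1) (not_lt.2 h2.le)
        have hx' : u x = x := u.injective (hu _ hx)
        rw [hx'] at h1 hx
        by_cases hy : (y : ℕ) < K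
        · rwa [hu y hy] at h1
        · rw [Fin.lt_def]; omega
      · refine ⟨h1, hw _ _ ?_ h2⟩
        apply hu'
        by_contra hy
        rw [hu y (by omega)] at h2
        by_cases hx : (x : ℕ) < K
        · rw [hu x hx] at h2
          exact absurd h1 (not_lt.2 h2.le)
        · rw [Fin.lt_def] at h1
          omega
  unfold len
  rw [key, card_disjUnion, card_map]

section Sums

variable {F : Type*} [Field F] {A : Type*} [Ring A] [Algebra F A] {n : ℕ} {q r : F}

lemma Tw_mul_sGen (D : BMWData F A n q r) {j : ℕ} (hj : j + 1 < n) (w : Equiv.Perm (Fin n))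
    (h : natVal w j < natVal w (j + 1)) :
    D.Tw (w * sGen n (j + 1)) = D.Tw w * D.T (j + 1) := by
  rw [D.Tw_mul _ _ (by rw [len_mul_sGen hj w h, len_sGen hj]),
    D.Tw_s _ (by omega) (by omega)]

/-- Right multiplication by an ascent multiplies the weighted sum by `q T_{j+1}`. -/
lemma hat_mul_T (D : BMWData F A n q r) {j : ℕ} (hj : j + 1 < n)
    {S S' : Finset (Equiv.Perm (Fin n))} (h : ∀ w ∈ S, natVal w j < natVal w (j + 1))
    (hS : ∀ w, w ∈ S' ↔ w * sGen n (j + 1) ∈ S) :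
    hat q D.Tw S' = q • (hat q D.Tw S * D.T (j + 1)) := by
  unfold hat
  rw [sum_mul, smul_sum]
  refine sum_equiv (Equiv.mulRight (sGen n (j + 1))) hS fun w hw => ?_
  have hw' := (hS w).1 hw
  have hmul : w = w * sGen n (j + 1) * sGen n (j + 1) := by
    rw [mul_assoc, sGen_mul_self, mul_one]
  simp only [Equiv.coe_mulRight]
  conv_lhs => rw [hmul]
  rw [len_mul_sGen hj _ (h _ hw'), Tw_mul_sGen D hj _ (h _ hw'), pow_succ', mul_smul,
    smul_mul_assoc]

/-! ### Commutation relations and the product `E_1 E_3 ⋯ E_{2f-1}` -/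

lemma E_eq (D : BMWData F A n q r) {i : ℕ} (h1 : 1 ≤ i) (h2 : i ≤ n - 1) :
    D.E i = 1 - (q - q⁻¹)⁻¹ • (D.T i - D.Tinv i) := by
  rw [D.skein i h1 h2, smul_smul, inv_mul_cancel₀ D.hqq, one_smul, sub_sub_cancel]

lemma commute_T_E (D : BMWData F A n q r) {i j : ℕ} (hi : 1 ≤ i) (hi' : i ≤ n - 1) (hj : 1 ≤ j)
    (hj' : j ≤ n - 1) (hij : i + 1 < j ∨ j + 1 < i) : Commute (D.T i) (D.E j) := by
  have h : Commute (D.T i) (D.T j) := D.T_comm i j hi hi' hj hj' hij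
  have h' : Commute (D.T i) (D.Tinv j) := by
    have e : D.T i * D.T j = D.T j * D.T i := h
    calc D.T i * D.Tinv j = D.Tinv j * D.T j * (D.T i * D.Tinv j) := by
          rw [D.Tinv_mul_T j hj hj', one_mul]
      _ = D.Tinv j * (D.T i * D.T j) * D.Tinv j := by rw [e]; simp only [mul_assoc]
      _ = D.Tinv j * D.T i * (D.T j * D.Tinv j) := by simp only [mul_assoc]
      _ = D.Tinv j * D.T i := by rw [D.T_mul_Tinv j hj hj', mul_one]
  rw [E_eq D hj hj']
  exact (Commute.one_right _).sub_right ((h.sub_right h').smul_right _)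

lemma commute_E_E (D : BMWData F A n q r) {i j : ℕ} (hi : 1 ≤ i) (hi' : i ≤ n - 1) (hj : 1 ≤ j)
    (hj' : j ≤ n - 1) (hij : i + 1 < j ∨ j + 1 < i) : Commute (D.E i) (D.E j) := by
  have h : Commute (D.T i) (D.E j) := commute_T_E D hi hi' hj hj' hij
  have h' : Commute (D.Tinv i) (D.E j) := by
    have e : D.T i * D.E j = D.E j * D.T i := h
    calc D.Tinv i * D.E j = D.Tinv i * D.E j * (D.T i * D.Tinv i) := by
          rw [D.T_mul_Tinv i hi hi', mul_one]
      _ = D.Tinv i * (D.E j * D.T i) * D.Tinv i := by simp only [mul_assoc]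
      _ = D.Tinv i * D.T i * D.E j * D.Tinv i := by rw [← e]; simp only [mul_assoc]
      _ = D.E j * D.Tinv i := by rw [D.Tinv_mul_T i hi hi', one_mul]
  rw [E_eq D hi hi']
  exact (Commute.one_left _).sub_left ((h.sub_left h').smul_left _)

lemma Ehat_succ (E : ℕ → A) (f : ℕ) : Ehat E (f + 1) = Ehat E f * E (2 * f + 1) := by
  simp [Ehat, List.range_succ]

lemma commute_E_Ehat (D : BMWData F A n q r) {f k : ℕ} (hfk : f ≤ k) (hk : 2 * k + 1 ≤ n - 1) :
    Commute (D.E (2 * k + 1)) (Ehat D.E f) := by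
  refine Commute.list_prod_right _ _ fun x hx => ?_
  obtain ⟨i, hi, rfl⟩ := List.mem_map.1 hx
  rw [List.mem_range] at hi
  exact commute_E_E D (by omega) hk (by omega) (by omega) (by omega)

lemma exists_Ehat_eq (D : BMWData F A n q r) {f k : ℕ} (hfn : 2 * f ≤ n) (hk : k < f) :
    ∃ X, Ehat D.E f = D.E (2 * k + 1) * X := by
  induction f with
  | zero => omega
  | succ f ih =>
    rw [Ehat_succ]
    rcases Nat.lt_succ_iff_lt_or_eq.1 hk with h | rfl
    · obtain ⟨X, hX⟩ := ih (by omega) h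
      exact ⟨X * D.E (2 * f + 1), by rw [hX, mul_assoc]⟩
    · exact ⟨Ehat D.E k, (commute_E_Ehat D le_rfl (by omega)).eq.symm⟩

lemma exists_Ehat_eq_mul (D : BMWData F A n q r) {f k : ℕ} (hfn : 2 * f ≤ n) (hk : k + 1 < f) :
    ∃ X, Ehat D.E f = D.E (2 * k + 1) * D.E (2 * k + 3) * X := by
  induction f with
  | zero => omega
  | succ f ih =>
    rw [Ehat_succ]
    rcases Nat.lt_succ_iff_lt_or_eq.1 hk with h | rfl
    · obtain ⟨X, hX⟩ := ih (by omega) h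
      exact ⟨X * D.E (2 * f + 1), by rw [hX, mul_assoc]⟩
    · refine ⟨Ehat D.E k, ?_⟩
      rw [Ehat_succ, mul_assoc]
      exact ((commute_E_Ehat D le_rfl (by omega)).mul_left
        (commute_E_Ehat (k := k + 1) D (by omega) (by omega))).eq.symm

/-- Exchanging two neighbouring arcs: the weighted sums over the three configurations of two arcs
on four points, in either order, differ by the factor `q²`. -/
lemma arc_exchange (D : BMWData F A n q r) {a : ℕ} (ha : 1 ≤ a) (ha' : a + 2 ≤ n - 1) :
    (q ^ 4 • (D.T (a + 1) * D.T a * D.T (a + 2) * D.T (a + 1)) + q ^ 2 • (D.T a * D.T (a + 1)) +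
        q ^ 3 • (D.T a * D.T (a + 2) * D.T (a + 1))) * (D.E a * D.E (a + 2)) =
      q ^ 2 • ((1 + q • D.T (a + 1) + q ^ 2 • (D.T (a + 2) * D.T (a + 1))) *
        (D.E a * D.E (a + 2))) := by
  have hq := D.hq
  have hc : D.E a * D.E (a + 2) = D.E (a + 2) * D.E a :=
    (commute_E_E D ha (by omega) (by omega) ha' (by omega)).eq
  have h32 : D.T (a + 2) * D.T (a + 1) * (D.E a * D.E (a + 2)) =
      D.E (a + 1) * (D.E a * D.E (a + 2)) := by
    rw [hc, ← mul_assoc, D.TTE₂ (a + 1) (by omega) (by omega), mul_assoc]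
  have h12 : D.T a * D.T (a + 1) * (D.E a * D.E (a + 2)) =
      D.E (a + 1) * (D.E a * D.E (a + 2)) := by
    rw [← mul_assoc, D.TTE₁ a ha (by omega), mul_assoc]
  have h2132 : D.T (a + 1) * D.T a * D.T (a + 2) * D.T (a + 1) * (D.E a * D.E (a + 2)) =
      D.E a * D.E (a + 2) := by
    calc _ = D.T (a + 1) * D.T a * (D.T (a + 2) * D.T (a + 1) * (D.E a * D.E (a + 2))) := by
          simp only [mul_assoc]
      _ = D.T (a + 1) * D.T a * D.E (a + 1) * D.E a * D.E (a + 2) := by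
          rw [h32]; simp only [mul_assoc]
      _ = _ := by rw [D.TTE₂ a ha (by omega), D.EEE₁ a ha (by omega)]
  have h132 : D.T a * D.T (a + 2) * D.T (a + 1) * (D.E a * D.E (a + 2)) =
      D.Tinv (a + 1) * (D.E a * D.E (a + 2)) := by
    conv_rhs => rw [← h2132]
    simp only [← mul_assoc]
    rw [D.Tinv_mul_T (a + 1) (by omega) (by omega), one_mul]
  have hT : D.Tinv (a + 1) = D.T (a + 1) - (q - q⁻¹) • (1 - D.E (a + 1)) := by
    rw [← D.skein (a + 1) (by omega) (by omega), sub_sub_cancel]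
  simp only [add_mul, smul_mul_assoc, h32, h12, h2132, h132, hT, one_mul, sub_mul, smul_add,
    smul_sub, smul_smul]
  generalize D.T (a + 1) * (D.E a * D.E (a + 2)) = x
  generalize D.E (a + 1) * (D.E a * D.E (a + 2)) = y
  generalize D.E a * D.E (a + 2) = z
  have e : q ^ 3 * (q - q⁻¹) = q ^ 4 - q ^ 2 := by field_simp
  rw [e]
  module

open scoped Classical in
/-- The permutations whose sequence of values `natVal w` satisfies `p`. -/
noncomputable def permSet (n : ℕ) (p : (ℕ → ℕ) → Prop) : Finset (Equiv.Perm (Fin n)) :=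
  univ.filter fun w => p (natVal w)

lemma mem_permSet {p : (ℕ → ℕ) → Prop} {w : Equiv.Perm (Fin n)} :
    w ∈ permSet n p ↔ p (natVal w) := by
  simp [permSet]

lemma permSet_congr {p p' : (ℕ → ℕ) → Prop} (h : ∀ v, p v ↔ p' v) :
    permSet n p = permSet n p' := by
  ext w
  rw [mem_permSet, mem_permSet, h]

lemma hat_permSet_add (D : BMWData F A n q r) {p p₁ p₂ : (ℕ → ℕ) → Prop}
    (h : ∀ w : Equiv.Perm (Fin n), p (natVal w) ↔ p₁ (natVal w) ∨ p₂ (natVal w))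
    (hd : ∀ v, p₁ v → ¬ p₂ v) :
    hat q D.Tw (permSet n p) = hat q D.Tw (permSet n p₁) + hat q D.Tw (permSet n p₂) := by
  classical
  have hu : permSet n p = permSet n p₁ ∪ permSet n p₂ := by
    ext w
    rw [mem_union, mem_permSet, mem_permSet, mem_permSet, h]
  have hdis : Disjoint (permSet n p₁) (permSet n p₂) :=
    disjoint_left.2 fun w h₁ h₂ => hd _ (mem_permSet.1 h₁) (mem_permSet.1 h₂)
  rw [hu, hat, sum_union hdis]
  rfl

/-- Permutations satisfying `G` whose values at the positions `x₀, x₁, x₂, x₃` increase. -/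
noncomputable def patternSet (n : ℕ) (G : (ℕ → ℕ) → Prop) (x₀ x₁ x₂ x₃ : ℕ) :
    Finset (Equiv.Perm (Fin n)) :=
  permSet n fun v => G v ∧ v x₀ < v x₁ ∧ v x₁ < v x₂ ∧ v x₂ < v x₃

lemma natVal_mul_sGen_eq_comp {j : ℕ} (hj : j + 1 < n) (w : Equiv.Perm (Fin n)) :
    natVal (w * sGen n (j + 1)) = natVal w ∘ Equiv.swap j (j + 1) :=
  funext (natVal_mul_sGen hj w)

lemma hat_patternSet (D : BMWData F A n q r) {G : (ℕ → ℕ) → Prop} {j k : ℕ} (hjk : j + 1 = k)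
    (x₀ x₁ x₂ x₃ y₀ y₁ y₂ y₃ : ℕ)
    (hG : ∀ v, G (v ∘ Equiv.swap j k) ↔ G v) (hk : k < n := by omega)
    (h : ∀ v : ℕ → ℕ, v x₀ < v x₁ → v x₁ < v x₂ → v x₂ < v x₃ → v j < v k := by omega)
    (h₀ : Equiv.swap j k y₀ = x₀ := by simp [Equiv.swap_apply_def])
    (h₁ : Equiv.swap j k y₁ = x₁ := by simp [Equiv.swap_apply_def])
    (h₂ : Equiv.swap j k y₂ = x₂ := by simp [Equiv.swap_apply_def])
    (h₃ : Equiv.swap j k y₃ = x₃ := by simp [Equiv.swap_apply_def]) :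
    hat q D.Tw (patternSet n G y₀ y₁ y₂ y₃) =
      q • (hat q D.Tw (patternSet n G x₀ x₁ x₂ x₃) * D.T k) := by
  subst hjk
  refine hat_mul_T D hk (fun w hw => ?_) fun w => ?_
  · obtain ⟨-, a, b, c⟩ := mem_permSet.1 hw
    exact h _ a b c
  · have hinv : ∀ x y, Equiv.swap j (j + 1) y = x → Equiv.swap j (j + 1) x = y := by
      rintro x y rfl
      simp
    rw [patternSet, patternSet, mem_permSet, mem_permSet, natVal_mul_sGen_eq_comp hk, hG]
    simp only [Function.comp, hinv _ _ h₀, hinv _ _ h₁, hinv _ _ h₂, hinv _ _ h₃]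

section FourPoints

variable {G : (ℕ → ℕ) → Prop} {p : ℕ}

lemma hat_sorted_arcs (D : BMWData F A n q r) (hp : p + 3 < n)
    (hG : ∀ c, p ≤ c → c ≤ p + 2 → ∀ v, G (v ∘ Equiv.swap c (c + 1)) ↔ G v) :
    hat q D.Tw (permSet n fun v => G v ∧ v p < v (p + 1) ∧ v (p + 2) < v (p + 3) ∧
        v p < v (p + 2)) =
      hat q D.Tw (patternSet n G p (p + 1) (p + 2) (p + 3)) *
        (1 + q • D.T (p + 2) + q ^ 2 • (D.T (p + 3) * D.T (p + 2))) := by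
  have h1324 := hat_patternSet D (j := p + 1) (k := p + 2) rfl
    p (p + 1) (p + 2) (p + 3) p (p + 2) (p + 1) (p + 3) (hG _ (by omega) (by omega))
  have h1243 := hat_patternSet D (j := p + 2) (k := p + 3) rfl
    p (p + 1) (p + 2) (p + 3) p (p + 1) (p + 3) (p + 2) (hG _ (by omega) (by omega))
  have h1423 := hat_patternSet D (j := p + 1) (k := p + 2) rfl
    p (p + 1) (p + 3) (p + 2) p (p + 2) (p + 3) (p + 1) (hG _ (by omega) (by omega))
  have hsplit : hat q D.Tw (permSet n fun v => G v ∧ v p < v (p + 1) ∧ v (p + 2) < v (p + 3) ∧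
        v p < v (p + 2)) = hat q D.Tw (patternSet n G p (p + 1) (p + 2) (p + 3)) +
      (hat q D.Tw (patternSet n G p (p + 2) (p + 1) (p + 3)) +
        hat q D.Tw (patternSet n G p (p + 2) (p + 3) (p + 1))) := by
    unfold patternSet
    rw [← hat_permSet_add D (p := fun v => G v ∧ v p < v (p + 2) ∧ v (p + 2) < v (p + 1) ∧
      v (p + 2) < v (p + 3)), ← hat_permSet_add D]
    · intro w
      have := mt (natVal_injOn w (x := p + 1) (y := p + 2) (by omega) (by omega)) (by omega)
      by_cases h : G (natVal w) <;> simp only [h, true_and, false_and, or_self]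
      omega
    · rintro v ⟨-, h₁⟩ ⟨-, h₂⟩
      omega
    · intro w
      have := mt (natVal_injOn w (x := p + 1) (y := p + 3) (by omega) (by omega)) (by omega)
      by_cases h : G (natVal w) <;> simp only [h, true_and, false_and, or_self]
      omega
    · rintro v ⟨-, h₁⟩ ⟨-, h₂⟩
      omega
  rw [hsplit, h1324, h1423, h1243]
  simp only [mul_add, mul_one, mul_smul_comm, smul_mul_assoc, smul_smul, mul_assoc, pow_two,
    add_assoc]

lemma hat_unsorted_arcs (D : BMWData F A n q r) (hp : p + 3 < n)
    (hG : ∀ c, p ≤ c → c ≤ p + 2 → ∀ v, G (v ∘ Equiv.swap c (c + 1)) ↔ G v) :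
    hat q D.Tw (permSet n fun v => G v ∧ v p < v (p + 1) ∧ v (p + 2) < v (p + 3) ∧
        v (p + 2) < v p) =
      hat q D.Tw (patternSet n G p (p + 1) (p + 2) (p + 3)) *
        (q ^ 4 • (D.T (p + 2) * D.T (p + 1) * D.T (p + 3) * D.T (p + 2)) +
          q ^ 2 • (D.T (p + 1) * D.T (p + 2)) +
          q ^ 3 • (D.T (p + 1) * D.T (p + 3) * D.T (p + 2))) := by
  have h1324 := hat_patternSet D (j := p + 1) (k := p + 2) rfl
    p (p + 1) (p + 2) (p + 3) p (p + 2) (p + 1) (p + 3) (hG _ (by omega) (by omega))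
  have h3124 := hat_patternSet D (j := p) (k := p + 1) rfl
    p (p + 2) (p + 1) (p + 3) (p + 1) (p + 2) p (p + 3) (hG _ (by omega) (by omega))
  have h3142 := hat_patternSet D (j := p + 2) (k := p + 3) rfl
    (p + 1) (p + 2) p (p + 3) (p + 1) (p + 3) p (p + 2) (hG _ (by omega) (by omega))
  have h3412 := hat_patternSet D (j := p + 1) (k := p + 2) rfl
    (p + 1) (p + 3) p (p + 2) (p + 2) (p + 3) p (p + 1) (hG _ (by omega) (by omega))
  have h2134 := hat_patternSet D (j := p) (k := p + 1) rfl
    p (p + 1) (p + 2) (p + 3) (p + 1) p (p + 2) (p + 3) (hG _ (by omega) (by omega))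
  have h2314 := hat_patternSet D (j := p + 1) (k := p + 2) rfl
    (p + 1) p (p + 2) (p + 3) (p + 2) p (p + 1) (p + 3) (hG _ (by omega) (by omega))
  have h2143 := hat_patternSet D (j := p + 2) (k := p + 3) rfl
    (p + 1) p (p + 2) (p + 3) (p + 1) p (p + 3) (p + 2) (hG _ (by omega) (by omega))
  have h2413 := hat_patternSet D (j := p + 1) (k := p + 2) rfl
    (p + 1) p (p + 3) (p + 2) (p + 2) p (p + 3) (p + 1) (hG _ (by omega) (by omega))
  have hsplit : hat q D.Tw (permSet n fun v => G v ∧ v p < v (p + 1) ∧ v (p + 2) < v (p + 3) ∧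
        v (p + 2) < v p) = hat q D.Tw (patternSet n G (p + 2) (p + 3) p (p + 1)) +
      (hat q D.Tw (patternSet n G (p + 2) p (p + 1) (p + 3)) +
        hat q D.Tw (patternSet n G (p + 2) p (p + 3) (p + 1))) := by
    unfold patternSet
    rw [← hat_permSet_add D (p := fun v => G v ∧ v (p + 2) < v p ∧ v p < v (p + 1) ∧
      v p < v (p + 3)), ← hat_permSet_add D]
    · intro w
      have := mt (natVal_injOn w (x := p) (y := p + 3) (by omega) (by omega)) (by omega)
      by_cases h : G (natVal w) <;> simp only [h, true_and, false_and, or_self]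
      omega
    · rintro v ⟨-, h₁⟩ ⟨-, h₂⟩
      omega
    · intro w
      have := mt (natVal_injOn w (x := p + 1) (y := p + 3) (by omega) (by omega)) (by omega)
      by_cases h : G (natVal w) <;> simp only [h, true_and, false_and, or_self]
      omega
    · rintro v ⟨-, h₁⟩ ⟨-, h₂⟩
      omega
  rw [hsplit, h3412, h3142, h3124, h1324, h2314, h2413, h2143, h2134]
  simp only [mul_add, mul_smul_comm, smul_mul_assoc, smul_smul, mul_assoc]
  module

end FourPoints

/-! ### Sorting the arcs -/

/-- The arcs `1, …, f` are oriented upwards. -/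
def ArcsUp (f : ℕ) (v : ℕ → ℕ) : Prop := ∀ i < f, v (2 * i) < v (2 * i + 1)

/-- The first `j` arcs have smaller left end points than all arcs following them. -/
def SortedTo (f j : ℕ) (v : ℕ → ℕ) : Prop :=
  ArcsUp f v ∧ ∀ i < j, ∀ m < f, i < m → v (2 * i) < v (2 * m)

/-- The first `j` arcs are sorted, and the next smallest arc sits in place `k`. -/
def MinAt (f j k : ℕ) (v : ℕ → ℕ) : Prop :=
  SortedTo f j v ∧ ∀ m < f, j ≤ m → m ≠ k → v (2 * k) < v (2 * m)

/-- The part of the conditions `MinAt f j k` and `MinAt f j (k + 1)` which does not depend on the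
configuration of the arcs `k` and `k + 1` on their four end points. -/
def MinInBlock (f j k : ℕ) (v : ℕ → ℕ) : Prop :=
  (∀ i < f, i ≠ k → i ≠ k + 1 → v (2 * i) < v (2 * i + 1)) ∧
  (∀ i < j, ∀ m < f, i < m → m ≠ k → m ≠ k + 1 → v (2 * i) < v (2 * m)) ∧
  (∀ i < j, ∀ x, 2 * k ≤ x → x < 2 * k + 4 → v (2 * i) < v x) ∧
  (∀ m < f, j ≤ m → m ≠ k → m ≠ k + 1 → ∃ x, 2 * k ≤ x ∧ x < 2 * k + 4 ∧ v x < v (2 * m))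

lemma MinInBlock.comp_swap {f j k c : ℕ} (hjk : j ≤ k) {v : ℕ → ℕ} (h : MinInBlock f j k v)
    (hc : 2 * k ≤ c) (hc' : c ≤ 2 * k + 2) : MinInBlock f j k (v ∘ Equiv.swap c (c + 1)) := by
  have hoff : ∀ x, x < 2 * k ∨ 2 * k + 4 ≤ x → Equiv.swap c (c + 1) x = x := fun x hx =>
    Equiv.swap_apply_of_ne_of_ne (by omega) (by omega)
  have hin : ∀ x, 2 * k ≤ x → x < 2 * k + 4 →
      2 * k ≤ Equiv.swap c (c + 1) x ∧ Equiv.swap c (c + 1) x < 2 * k + 4 := by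
    intro x h1 h2
    rw [Equiv.swap_apply_def]
    split_ifs <;> omega
  obtain ⟨h1, h2, h3, h4⟩ := h
  refine ⟨fun i hi hk hk' => ?_, fun i hi m hm him hk hk' => ?_, fun i hi x hx hx' => ?_,
    fun m hm hjm hk hk' => ?_⟩
  · simpa only [Function.comp, hoff (2 * i) (by omega), hoff (2 * i + 1) (by omega)]
      using h1 i hi hk hk'
  · simpa only [Function.comp, hoff (2 * i) (by omega), hoff (2 * m) (by omega)]
      using h2 i hi m hm him hk hk'
  · simpa only [Function.comp, hoff (2 * i) (by omega)]
      using h3 i hi _ (hin x hx hx').1 (hin x hx hx').2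
  · obtain ⟨x, hx, hx', hlt⟩ := h4 m hm hjm hk hk'
    refine ⟨Equiv.swap c (c + 1) x, (hin x hx hx').1, (hin x hx hx').2, ?_⟩
    simpa only [Function.comp, hoff (2 * m) (by omega), Equiv.swap_apply_self] using hlt

lemma minInBlock_comp_swap_iff {f j k : ℕ} (hjk : j ≤ k) (c : ℕ)
    (hc : 2 * k ≤ c) (hc' : c ≤ 2 * k + 2) (v : ℕ → ℕ) :
    MinInBlock f j k (v ∘ Equiv.swap c (c + 1)) ↔ MinInBlock f j k v := by
  refine ⟨fun h => ?_, fun h => h.comp_swap hjk hc hc'⟩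
  have := h.comp_swap hjk hc hc'
  rwa [Function.comp_assoc, ← Equiv.Perm.coe_mul, Equiv.swap_mul_self, Equiv.Perm.coe_one,
    Function.comp_id] at this

lemma minAt_iff {f j k : ℕ} (hjk : j ≤ k) (hk : k + 1 < f) (v : ℕ → ℕ) :
    MinAt f j k v ↔ MinInBlock f j k v ∧ v (2 * k) < v (2 * k + 1) ∧
      v (2 * k + 2) < v (2 * k + 3) ∧ v (2 * k) < v (2 * k + 2) := by
  have key : ∀ x, 2 * k ≤ x → x < 2 * k + 4 →
      x = 2 * k ∨ x = 2 * k + 1 ∨ x = 2 * k + 2 ∨ x = 2 * k + 3 := by omega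
  constructor
  · rintro ⟨⟨h1, h2⟩, h3⟩
    have a1 := h1 k (by omega)
    have a2 : v (2 * k + 2) < v (2 * k + 3) := h1 (k + 1) hk
    have a3 : v (2 * k) < v (2 * k + 2) := h3 (k + 1) hk (by omega) (by omega)
    refine ⟨⟨fun i hi _ _ => h1 i hi, fun i hi m hm him _ _ => h2 i hi m hm him,
      fun i hi x hx hx' => ?_, fun m hm hjm hmk _ => ⟨2 * k, by omega, by omega, h3 m hm hjm hmk⟩⟩,
      a1, a2, a3⟩
    have := h2 i hi k (by omega) (by omega)
    rcases key x hx hx' with rfl | rfl | rfl | rfl <;> omega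
  · rintro ⟨⟨h1, h2, h3, h4⟩, a1, a2, a3⟩
    refine ⟨⟨fun i hi => ?_, fun i hi m hm him => ?_⟩, fun m hm hjm hmk => ?_⟩
    · by_cases e : i = k
      · rw [e]; exact a1
      by_cases e' : i = k + 1
      · rw [e', mul_add, mul_one]; exact a2
      exact h1 i hi e e'
    · by_cases e : m = k ∨ m = k + 1
      · exact h3 i hi _ (by omega) (by omega)
      · exact h2 i hi m hm him (by tauto) (by tauto)
    · by_cases e' : m = k + 1
      · rw [e', mul_add, mul_one]; exact a3
      obtain ⟨x, hx, hx', h⟩ := h4 m hm hjm hmk e'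
      rcases key x hx hx' with rfl | rfl | rfl | rfl <;> omega

lemma minAt_succ_iff {f j k : ℕ} (hjk : j ≤ k) (hk : k + 1 < f) (v : ℕ → ℕ) :
    MinAt f j (k + 1) v ↔ MinInBlock f j k v ∧ v (2 * k) < v (2 * k + 1) ∧
      v (2 * k + 2) < v (2 * k + 3) ∧ v (2 * k + 2) < v (2 * k) := by
  have key : ∀ x, 2 * k ≤ x → x < 2 * k + 4 →
      x = 2 * k ∨ x = 2 * k + 1 ∨ x = 2 * k + 2 ∨ x = 2 * k + 3 := by omega
  unfold MinAt
  rw [mul_add, mul_one]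
  constructor
  · rintro ⟨⟨h1, h2⟩, h3⟩
    have a1 := h1 k (by omega)
    have a2 : v (2 * k + 2) < v (2 * k + 3) := h1 (k + 1) hk
    have a3 := h3 k (by omega) hjk (by omega)
    refine ⟨⟨fun i hi _ _ => h1 i hi, fun i hi m hm him _ _ => h2 i hi m hm him,
      fun i hi x hx hx' => ?_,
      fun m hm hjm _ hmk => ⟨2 * k + 2, by omega, by omega, h3 m hm hjm hmk⟩⟩, a1, a2, a3⟩
    have : v (2 * i) < v (2 * k + 2) := h2 i hi (k + 1) hk (by omega)
    rcases key x hx hx' with rfl | rfl | rfl | rfl <;> omega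
  · rintro ⟨⟨h1, h2, h3, h4⟩, a1, a2, a3⟩
    refine ⟨⟨fun i hi => ?_, fun i hi m hm him => ?_⟩, fun m hm hjm hmk => ?_⟩
    · by_cases e : i = k
      · rw [e]; exact a1
      by_cases e' : i = k + 1
      · rw [e', mul_add, mul_one]; exact a2
      exact h1 i hi e e'
    · by_cases e : m = k ∨ m = k + 1
      · exact h3 i hi _ (by omega) (by omega)
      · exact h2 i hi m hm him (by tauto) (by tauto)
    · by_cases e' : m = k
      · rw [e']; exact a3
      obtain ⟨x, hx, hx', h⟩ := h4 m hm hjm e' hmk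
      rcases key x hx hx' with rfl | rfl | rfl | rfl <;> omega

lemma hat_minAt_succ (D : BMWData F A n q r) {f j k : ℕ} (hfn : 2 * f ≤ n) (hjk : j ≤ k)
    (hk : k + 1 < f) : hat q D.Tw (permSet n (MinAt f j (k + 1))) * Ehat D.E f =
      q ^ 2 • (hat q D.Tw (permSet n (MinAt f j k)) * Ehat D.E f) := by
  have hG : ∀ c, 2 * k ≤ c → c ≤ 2 * k + 2 → ∀ v,
      MinInBlock f j k (v ∘ Equiv.swap c (c + 1)) ↔ MinInBlock f j k v :=
    fun c hc hc' v => minInBlock_comp_swap_iff hjk c hc hc' v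
  obtain ⟨X, hX⟩ := exists_Ehat_eq_mul D hfn hk
  rw [permSet_congr (p := MinAt f j (k + 1)) (minAt_succ_iff hjk hk),
    permSet_congr (p := MinAt f j k) (minAt_iff hjk hk),
    hat_sorted_arcs D (by omega) hG, hat_unsorted_arcs D (by omega) hG, hX]
  have h := arc_exchange D (a := 2 * k + 1) (by omega) (by omega)
  rw [← mul_assoc _ _ X, mul_assoc _ _ (D.E (2 * k + 1) * D.E (2 * k + 3)), ← mul_assoc _ _ X,
    mul_assoc _ _ (D.E (2 * k + 1) * D.E (2 * k + 3)), h, mul_smul_comm, smul_mul_assoc]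

lemma hat_minAt (D : BMWData F A n q r) {f j : ℕ} (hfn : 2 * f ≤ n) (t : ℕ) (ht : j + t < f) :
    hat q D.Tw (permSet n (MinAt f j (j + t))) * Ehat D.E f =
      q ^ (2 * t) • (hat q D.Tw (permSet n (MinAt f j j)) * Ehat D.E f) := by
  induction t with
  | zero => simp
  | succ t ih =>
    rw [← add_assoc, hat_minAt_succ D hfn (by omega) (by omega), ih (by omega), smul_smul,
      ← pow_add]
    congr 2
    ring

lemma minAt_self_iff {f j : ℕ} (v : ℕ → ℕ) :
    MinAt f j j v ↔ SortedTo f (j + 1) v := by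
  constructor
  · rintro ⟨⟨h1, h2⟩, h3⟩
    refine ⟨h1, fun i hi m hm him => ?_⟩
    rcases Nat.lt_succ_iff_lt_or_eq.1 hi with h | rfl
    · exact h2 i h m hm him
    · exact h3 m hm him.le him.ne'
  · rintro ⟨h1, h2⟩
    exact ⟨⟨h1, fun i hi => h2 i (by omega)⟩, fun m hm hjm hne =>
      h2 j (by omega) m hm (by omega)⟩

lemma hat_sortedTo (D : BMWData F A n q r) {f j : ℕ} (hfn : 2 * f ≤ n) (hj : j < f) :
    hat q D.Tw (permSet n (SortedTo f j)) =
      ∑ t ∈ range (f - j), hat q D.Tw (permSet n (MinAt f j (j + t))) := by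
  classical
  have hu : permSet n (SortedTo f j) =
      (range (f - j)).biUnion fun t => permSet n (MinAt f j (j + t)) := by
    ext w
    simp only [mem_biUnion, mem_permSet, mem_range]
    constructor
    · intro h
      obtain ⟨t, ht, hmin⟩ := exists_min_image (range (f - j))
        (fun t => natVal w (2 * (j + t))) ⟨0, by rw [mem_range]; omega⟩
      rw [mem_range] at ht
      refine ⟨t, ht, h, fun m hm hjm hne => ?_⟩
      have h1 := hmin (m - j) (by rw [mem_range]; omega)
      rw [show j + (m - j) = m by omega] at h1
      refine lt_of_le_of_ne h1 fun he => hne ?_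
      have := natVal_injOn w (by omega) (by omega) he
      omega
    · rintro ⟨t, -, h, -⟩
      exact h
  rw [hu, hat, sum_biUnion]
  · rfl
  · intro s hs t ht hst
    rw [coe_range, Set.mem_Iio] at hs ht
    refine disjoint_left.2 fun w h1 h2 => ?_
    have a1 := (mem_permSet.1 h1).2 (j + t) (by omega) (by omega) (by omega)
    have a2 := (mem_permSet.1 h2).2 (j + s) (by omega) (by omega) (by omega)
    omega

lemma hat_sortedTo_mul_Ehat (D : BMWData F A n q r) {f : ℕ} (hfn : 2 * f ≤ n) (m : ℕ)
    (hm : m ≤ f) : hat q D.Tw (permSet n (SortedTo f (f - m))) * Ehat D.E f =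
      aseq q m • (hat q D.Tw (permSet n (SortedTo f f)) * Ehat D.E f) := by
  induction m with
  | zero => simp [aseq]
  | succ m ih =>
    rw [hat_sortedTo D hfn (by omega), sum_mul,
      sum_congr rfl fun t ht => hat_minAt D hfn t (by rw [mem_range] at ht; omega), ← sum_smul,
      permSet_congr minAt_self_iff, show f - (m + 1) + 1 = f - m by omega,
      ih (by omega), smul_smul, show f - (f - (m + 1)) = m + 1 by omega, aseq, mul_comm]

lemma hat_arcsUp_mul_Ehat (D : BMWData F A n q r) {f : ℕ} (hfn : 2 * f ≤ n) :
    hat q D.Tw (permSet n (ArcsUp f)) * Ehat D.E f =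
      aseq q f • (hat q D.Tw (permSet n (SortedTo f f)) * Ehat D.E f) := by
  rw [← hat_sortedTo_mul_Ehat D hfn f le_rfl]
  congr 2
  exact permSet_congr fun v => by simp [SortedTo]

lemma hat_arcsUp_succ (D : BMWData F A n q r) {k : ℕ} (hk : 2 * k + 1 < n) :
    hat q D.Tw (permSet n (ArcsUp k)) =
      hat q D.Tw (permSet n (ArcsUp (k + 1))) * (1 + q • D.T (2 * k + 1)) := by
  have hup : ∀ v : ℕ → ℕ, ArcsUp k (v ∘ Equiv.swap (2 * k) (2 * k + 1)) ↔ ArcsUp k v := by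
    intro v
    refine forall₂_congr fun i hi => ?_
    simp only [Function.comp]
    rw [Equiv.swap_apply_of_ne_of_ne (by omega) (by omega),
      Equiv.swap_apply_of_ne_of_ne (by omega) (by omega)]
  have hsucc : ∀ v : ℕ → ℕ, ArcsUp (k + 1) v ↔ ArcsUp k v ∧ v (2 * k) < v (2 * k + 1) :=
    fun v => Nat.forall_lt_succ_right
  rw [hat_permSet_add D (p₁ := ArcsUp (k + 1))
    (p₂ := fun v => ArcsUp k v ∧ v (2 * k + 1) < v (2 * k)), mul_add, mul_one, mul_smul_comm,
    ← hat_mul_T D hk]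
  · intro w hw
    exact ((hsucc _).1 (mem_permSet.1 hw)).2
  · intro w
    rw [mem_permSet, mem_permSet, natVal_mul_sGen_eq_comp hk, hsucc, hup]
    simp
  · intro w
    have := mt (natVal_injOn w (x := 2 * k) (y := 2 * k + 1) (by omega) hk) (by omega)
    rw [hsucc, ← and_or_left, iff_self_and]
    intro
    omega
  · intro v h1 h2
    have := ((hsucc v).1 h1).2
    omega

lemma hat_univ_mul_Ehat (D : BMWData F A n q r) {f : ℕ} (hfn : 2 * f ≤ n) (k : ℕ) (hk : k ≤ f) :
    hat q D.Tw univ * Ehat D.E f =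
      (1 + q * r⁻¹) ^ k • (hat q D.Tw (permSet n (ArcsUp k)) * Ehat D.E f) := by
  induction k with
  | zero =>
    rw [pow_zero, one_smul]
    congr 2
    ext w
    simp [mem_permSet, ArcsUp]
  | succ k ih =>
    obtain ⟨X, hX⟩ := exists_Ehat_eq D hfn (k := k) (by omega)
    have h : (1 + q • D.T (2 * k + 1)) * Ehat D.E f = (1 + q * r⁻¹) • Ehat D.E f := by
      rw [hX, add_mul, one_mul, smul_mul_assoc, ← mul_assoc, D.TE _ (by omega) (by omega),
        smul_mul_assoc, smul_smul, add_smul, one_smul]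
    rw [ih (by omega), hat_arcsUp_succ D (by omega), mul_assoc, h, mul_smul_comm, smul_smul,
      pow_succ]

/-! ### The coset decomposition for the points not on an arc -/

/-- The values at positions `K, …, n - 1` increase. -/
def TailIncr (n K : ℕ) (v : ℕ → ℕ) : Prop := ∀ x, K ≤ x → x + 1 < n → v x < v (x + 1)

lemma TailIncr.lt {K : ℕ} {v : ℕ → ℕ} (h : TailIncr n K v) {x y : ℕ} (hx : K ≤ x)
    (hxy : x < y) (hy : y < n) : v x < v y := by
  induction y, hxy using Nat.le_induction with
  | base => exact h x hx hy
  | succ y hxy ih => exact (ih (by omega)).trans (h y (by omega) hy)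

lemma TailIncr.apply_lt {K : ℕ} {w : Equiv.Perm (Fin n)} (h : TailIncr n K (natVal w))
    (a b : Fin n) (ha : K ≤ a) (hab : a < b) : w a < w b := by
  rw [Fin.lt_def, ← natVal_coe, ← natVal_coe]
  exact h.lt ha hab b.2

lemma mem_fixSet {K : ℕ} {u : Equiv.Perm (Fin n)} :
    u ∈ fixSet n K ↔ ∀ a : Fin n, (a : ℕ) < K → u a = a := by
  simp [fixSet]

lemma mul_mem_fixSet {K : ℕ} {u v : Equiv.Perm (Fin n)} (hu : u ∈ fixSet n K)
    (hv : v ∈ fixSet n K) : u * v ∈ fixSet n K := by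
  rw [mem_fixSet] at *
  intro a ha
  rw [Equiv.Perm.mul_apply, hv a ha, hu a ha]

lemma inv_mem_fixSet {K : ℕ} {u : Equiv.Perm (Fin n)} (hu : u ∈ fixSet n K) :
    u⁻¹ ∈ fixSet n K := by
  rw [mem_fixSet] at *
  intro a ha
  rw [Equiv.Perm.inv_eq_iff_eq, hu a ha]

lemma sGen_mem_fixSet {K j : ℕ} (hK : K ≤ j) (hj : j + 1 < n) :
    sGen n (j + 1) ∈ fixSet n K := by
  rw [mem_fixSet, sGen_succ hj]
  intro a ha
  exact Equiv.swap_apply_of_ne_of_ne (by simp only [ne_eq, Fin.ext_iff]; omega)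
    (by simp only [ne_eq, Fin.ext_iff]; omega)

lemma natVal_mul_of_fix {K x : ℕ} {u : Equiv.Perm (Fin n)} (hu : u ∈ fixSet n K)
    (w : Equiv.Perm (Fin n)) (hx : x < K) : natVal (w * u) x = natVal w x := by
  unfold natVal
  split_ifs with h
  · rw [Equiv.Perm.mul_apply, mem_fixSet.1 hu _ hx]
  · rfl

lemma exists_tailIncr (K : ℕ) (w : Equiv.Perm (Fin n)) :
    ∃ u ∈ fixSet n K, TailIncr n K (natVal (w * u)) := by
  obtain ⟨u, hu, hmin⟩ := exists_min_image (fixSet n K) (fun u => len (w * u))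
    ⟨1, mem_fixSet.2 fun _ _ => rfl⟩
  refine ⟨u, hu, fun x hx hxn => ?_⟩
  by_contra hlt
  have hne := mt (natVal_injOn (w * u) (x := x) (y := x + 1) (by omega) hxn) (by omega)
  have h1 := hmin _ (mul_mem_fixSet hu (sGen_mem_fixSet hx hxn))
  have h2 := len_mul_sGen hxn (w * u * sGen n (x + 1)) (by
    rw [natVal_mul_sGen hxn, natVal_mul_sGen hxn, Equiv.swap_apply_left, Equiv.swap_apply_right]
    omega)
  rw [mul_assoc, sGen_mul_self, mul_one] at h2
  rw [← mul_assoc] at h1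
  omega

lemma eq_one_of_tailIncr {K : ℕ} {w u : Equiv.Perm (Fin n)} (hu : u ∈ fixSet n K)
    (hw : TailIncr n K (natVal w)) (hwu : TailIncr n K (natVal (w * u))) : u = 1 := by
  have h1 := len_mul_of_fixes hw.apply_lt (mem_fixSet.1 hu)
  have h2 := len_mul_of_fixes hwu.apply_lt (mem_fixSet.1 (inv_mem_fixSet hu))
  rw [mul_inv_cancel_right] at h2
  have h0 : len u = 0 := by omega
  have hmono : StrictMono u := by
    intro a b hab
    by_contra h
    rw [len, card_eq_zero, filter_eq_empty_iff] at h0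
    exact h0 (mem_univ (a, b)) ⟨hab, lt_of_le_of_ne (not_lt.1 h) (u.injective.ne hab.ne')⟩
  ext a
  have := congrArg (fun e : Fin n ≃o Fin n => e a) (Subsingleton.elim
    (StrictMono.orderIsoOfSurjective u hmono u.surjective) (OrderIso.refl _))
  simpa using congrArg Fin.val this

/-- Weighted sums factor along cosets of the permutations fixing `1, …, K`. -/
lemma hat_permSet_eq_mul_fixSet (D : BMWData F A n q r) {K : ℕ} {p : (ℕ → ℕ) → Prop}
    (hp : ∀ v v' : ℕ → ℕ, (∀ x < K, v x = v' x) → p v → p v') :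
    hat q D.Tw (permSet n p) =
      hat q D.Tw (permSet n fun v => p v ∧ TailIncr n K v) * hat q D.Tw (fixSet n K) := by
  unfold hat
  rw [sum_mul_sum, ← sum_product']
  symm
  refine sum_bij (fun x _ => x.1 * x.2) ?_ ?_ ?_ ?_
  · rintro ⟨w, u⟩ h
    obtain ⟨hw, hu⟩ := mem_product.1 h
    exact mem_permSet.2 (hp _ _ (fun x hx => (natVal_mul_of_fix hu w hx).symm)
      (mem_permSet.1 hw).1)
  · rintro ⟨w, u⟩ h ⟨w', u'⟩ h' heq
    obtain ⟨hw, hu⟩ := mem_product.1 h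
    obtain ⟨hw', hu'⟩ := mem_product.1 h'
    simp only at hw hu hw' hu' heq
    have e : w = w' * (u' * u⁻¹) := by rw [← mul_assoc, ← heq, mul_inv_cancel_right]
    have h1 := eq_one_of_tailIncr (mul_mem_fixSet hu' (inv_mem_fixSet hu))
      (mem_permSet.1 hw').2 (e ▸ (mem_permSet.1 hw).2)
    rw [h1, mul_one] at e
    rw [e, mul_inv_eq_one.1 h1]
  · intro w hw
    obtain ⟨u, hu, h⟩ := exists_tailIncr K w
    refine ⟨(w * u, u⁻¹), mem_product.2 ⟨mem_permSet.2 ⟨hp _ _ (fun x hx =>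
      (natVal_mul_of_fix hu w hx).symm) (mem_permSet.1 hw), h⟩, inv_mem_fixSet hu⟩, ?_⟩
    simp
  · rintro ⟨w, u⟩ h
    obtain ⟨hw, hu⟩ := mem_product.1 h
    have hl := len_mul_of_fixes (mem_permSet.1 hw).2.apply_lt (mem_fixSet.1 hu)
    simp only
    rw [D.Tw_mul _ _ hl, hl, pow_add, smul_mul_smul_comm]

end Sums

lemma pimg_inv {n i : ℕ} (w : Equiv.Perm (Fin n)) (h : i < n) :
    pimg w⁻¹ (i + 1) = natVal w i + 1 := by
  simp [pimg, natVal, h]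

lemma image_inv_Hset {n f : ℕ} (hfn : 2 * f ≤ n) :
    (Hset n f).image (fun d => d⁻¹) =
      permSet n fun v => SortedTo f f v ∧ TailIncr n (2 * f) v := by
  ext w
  rw [mem_permSet, mem_image]
  have hinv : (∃ d ∈ Hset n f, d⁻¹ = w) ↔ w⁻¹ ∈ Hset n f :=
    ⟨by rintro ⟨d, hd, rfl⟩; rwa [inv_inv], fun h => ⟨_, h, inv_inv w⟩⟩
  rw [hinv]
  simp only [Hset, mem_filter, SortedTo, ArcsUp, TailIncr, mem_univ, true_and, mem_Icc]
  have hodd : ∀ i, i < f → pimg w⁻¹ (2 * (i + 1) - 1) = natVal w (2 * i) + 1 := fun i hi => by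
    rw [← pimg_inv w (by omega)]
    congr 1
  have heven : ∀ i, i < f → pimg w⁻¹ (2 * (i + 1)) = natVal w (2 * i + 1) + 1 := fun i hi => by
    rw [← pimg_inv w (by omega)]
    congr 1
  constructor
  · rintro ⟨h1, h2, h3⟩
    refine ⟨⟨fun i hi => ?_, fun i _ m hm him => ?_⟩, fun x hx hxn => ?_⟩
    · have := h2 (i + 1) (by omega)
      rw [hodd i hi, heven i hi] at this
      omega
    · induction m, him using Nat.le_induction with
      | base =>
        change natVal w (2 * i) < natVal w (2 * (i + 1))
        have := h1 (i + 1) (by omega)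
        rw [hodd i (by omega), show 2 * (i + 1) + 1 = 2 * (i + 1 + 1) - 1 by omega,
          hodd (i + 1) hm] at this
        omega
      | succ m him ih =>
        have := h1 (m + 1) (by omega)
        rw [hodd m (by omega), show 2 * (m + 1) + 1 = 2 * (m + 1 + 1) - 1 by omega,
          hodd (m + 1) hm] at this
        have := ih (by omega)
        omega
    · have := h3 (x + 1) (by omega)
      rw [pimg_inv w (by omega), pimg_inv w hxn] at this
      omega
  · rintro ⟨⟨h1, h2⟩, h3⟩
    refine ⟨fun i hi => ?_, fun i hi => ?_, fun j hj => ?_⟩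
    · obtain ⟨i, rfl⟩ := Nat.exists_eq_add_of_le' hi.1
      rw [hodd i (by omega), show 2 * (i + 1) + 1 = 2 * (i + 1 + 1) - 1 by omega,
        hodd (i + 1) (by omega)]
      have := h2 i (by omega) (i + 1) (by omega) (by omega)
      omega
    · obtain ⟨i, rfl⟩ := Nat.exists_eq_add_of_le' hi.1
      rw [hodd i (by omega), heven i (by omega)]
      have := h1 i (by omega)
      omega
    · obtain ⟨j, rfl⟩ := Nat.exists_eq_add_of_le' (show 1 ≤ j by omega)
      rw [pimg_inv w (by omega), pimg_inv w (by omega)]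
      have := h3 j (by omega) (by omega)
      omega

/-- For `0 ≤ 2f ≤ n`, `y_f = (1 + qr⁻¹)^f · a_f · x_f`, where
`y_f = Ŝ_n · Ê_f · Ĥ_f` and `x_f = (H_f⁻¹)^ · Ŝ_{{2f+1,…,n}} · Ê_f · Ĥ_f`. -/
theorem statement16 {F : Type*} [Field F] {A : Type*} [Ring A] [Algebra F A]
    {n : ℕ} (hn : 1 ≤ n) {q r : F} (D : BMWData F A n q r)
    (f : ℕ) (hfn : 2 * f ≤ n) :
    hat q D.Tw (Finset.univ : Finset (Equiv.Perm (Fin n))) * Ehat D.E f *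
        hat q D.Tw (Hset n f) =
      ((1 + q * r⁻¹) ^ f * aseq q f) •
        (hat q D.Tw ((Hset n f).image (fun d => d⁻¹)) * hat q D.Tw (fixSet n (2 * f)) *
          Ehat D.E f * hat q D.Tw (Hset n f)) := by
  have hC := hat_permSet_eq_mul_fixSet D (K := 2 * f) (p := SortedTo f f) (by
    rintro v v' h ⟨h1, h2⟩
    refine ⟨fun i hi => ?_, fun i hi m hm him => ?_⟩
    · rw [← h _ (by omega), ← h _ (by omega)]
      exact h1 i hi
    · rw [← h _ (by omega), ← h _ (by omega)]
      exact h2 i hi m hm him)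
  rw [hat_univ_mul_Ehat D hfn f le_rfl, hat_arcsUp_mul_Ehat D hfn, hC, smul_smul,
    smul_mul_assoc]
  congr!
  exact (image_inv_Hset hfn).symm

end BMWPaper
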